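/- (Theorem 3.1) Let (A, N) be a fuzzy Banach algebra and (B, N') a fuzzy normed linear space. Let φ : A × A → B be a function such that for some 0 < α < 2, N'(φ(2a, 2b), t) ≥ N'(α φ(a,b), t) for all a, b ∈ A and all t > 0. Suppose f : A → A is a function such that N(f(a+b) − f(a) − f(b), t) ≥ N'(φ(a,b), t) and N(f(a·b) − a·f(b) − f(a)·b, s) ≥ N'(φ(a,b), s) for all a, b ∈ A and all t, s > 0. Then there exists a unique ring derivation d : A → A (i.e., d(a+b) = d(a) + d(b) and d(a·b) = a·d(b) + d(a)·b for all a, b ∈ A) such that N(f(a) − d(a), t) ≥ N'((2/(2−α)) φ(a,a), t) for all a ∈ A and all t > 0. -/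

import Mathlib

open Filter Topology

/-- A fuzzy norm on a real linear space `X` (conditions (N1)–(N6), with values in `[0,1]`). -/
structure IsFuzzyNorm {X : Type*} [AddCommGroup X] [Module ℝ X] (N : X → ℝ → ℝ) : Prop where
  nonneg : ∀ (x : X) (a : ℝ), 0 ≤ N x a
  le_one : ∀ (x : X) (a : ℝ), N x a ≤ 1
  N1 : ∀ (x : X) (a : ℝ), a ≤ 0 → N x a = 0
  N2 : ∀ x : X, x = 0 ↔ ∀ a : ℝ, 0 < a → N x a = 1
  N3 : ∀ (x : X) (a b : ℝ), a ≠ 0 → N (a • x) b = N x (b / |a|)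
  N4 : ∀ (x y : X) (a b : ℝ), min (N x a) (N y b) ≤ N (x + y) (a + b)
  N5_mono : ∀ x : X, Monotone (N x)
  N5_lim : ∀ x : X, Tendsto (N x) atTop (𝓝 1)
  N6 : ∀ x : X, x ≠ 0 → Continuous (N x)

/-- Convergence of a sequence to `x` in a fuzzy normed linear space:
`lim_{n→∞} N (s n - x) a = 1` for all `a > 0`. -/
def FuzzyTendsto {X : Type*} [AddCommGroup X] [Module ℝ X] (N : X → ℝ → ℝ)
    (s : ℕ → X) (x : X) : Prop :=
  ∀ a : ℝ, 0 < a → Tendsto (fun n => N (s n - x) a) atTop (𝓝 1)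

/-- A sequence is Cauchy in a fuzzy normed linear space. -/
def FuzzyCauchy {X : Type*} [AddCommGroup X] [Module ℝ X] (N : X → ℝ → ℝ)
    (s : ℕ → X) : Prop :=
  ∀ ε : ℝ, 0 < ε → ∀ a : ℝ, 0 < a → ∃ n₀ : ℕ, ∀ n ≥ n₀, ∀ p : ℕ, 0 < p →
    1 - ε < N (s (n + p) - s n) a

/-- A fuzzy norm is complete if every Cauchy sequence converges. -/
def FuzzyComplete {X : Type*} [AddCommGroup X] [Module ℝ X] (N : X → ℝ → ℝ) : Prop :=
  ∀ s : ℕ → X, FuzzyCauchy N s → ∃ x : X, FuzzyTendsto N s x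

/-- A fuzzy Banach algebra: a real algebra with a complete fuzzy norm satisfying
`N (x*y) (a*b) ≥ min (N x a) (N y b)`. -/
structure IsFuzzyBanachAlgebra {X : Type*} [Ring X] [Algebra ℝ X] (N : X → ℝ → ℝ) : Prop where
  toIsFuzzyNorm : IsFuzzyNorm N
  complete : FuzzyComplete N
  mul : ∀ (x y : X) (a b : ℝ), min (N x a) (N y b) ≤ N (x * y) (a * b)

lemma FuzzyTendsto.sub_limit {X : Type*} [AddCommGroup X] [Module ℝ X] {N : X → ℝ → ℝ}
    {s : ℕ → X} {x : X} (hs : FuzzyTendsto N s x) : FuzzyTendsto N (fun n => s n - x) 0 := by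
  simpa only [FuzzyTendsto, sub_zero] using hs

namespace IsFuzzyNorm

variable {X : Type*} [AddCommGroup X] [Module ℝ X] {N : X → ℝ → ℝ}

lemma apply_zero (h : IsFuzzyNorm N) {t : ℝ} (ht : 0 < t) : N 0 t = 1 :=
  (h.N2 0).1 rfl t ht

lemma apply_neg (h : IsFuzzyNorm N) (x : X) (t : ℝ) : N (-x) t = N x t := by
  simpa using h.N3 x (-1) t (by norm_num)

lemma apply_sub_comm (h : IsFuzzyNorm N) (x y : X) (t : ℝ) : N (x - y) t = N (y - x) t := by
  rw [← neg_sub, h.apply_neg]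

lemma apply_smul_of_pos (h : IsFuzzyNorm N) (x : X) {c : ℝ} (hc : 0 < c) (t : ℝ) :
    N (c • x) t = N x (t / c) := by
  rw [h.N3 x c t hc.ne', abs_of_pos hc]

lemma tendsto_one_of_le (h : IsFuzzyNorm N) {s : ℕ → X} {g : ℕ → ℝ} {t : ℝ}
    (hg : Tendsto g atTop (𝓝 1)) (hle : ∀ n, g n ≤ N (s n) t) :
    Tendsto (fun n => N (s n) t) atTop (𝓝 1) :=
  tendsto_of_tendsto_of_tendsto_of_le_of_le hg tendsto_const_nhds hle fun _ => h.le_one _ _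

lemma fuzzyTendsto_add (h : IsFuzzyNorm N) {s u : ℕ → X} {x y : X}
    (hs : FuzzyTendsto N s x) (hu : FuzzyTendsto N u y) :
    FuzzyTendsto N (fun n => s n + u n) (x + y) := by
  intro t ht
  have hmin := (hs (t / 2) (half_pos ht)).min (hu (t / 2) (half_pos ht))
  rw [min_self] at hmin
  refine h.tendsto_one_of_le hmin fun n => ?_
  have := h.N4 (s n - x) (u n - y) (t / 2) (t / 2)
  rwa [add_halves, sub_add_sub_comm] at this

lemma fuzzyTendsto_neg (h : IsFuzzyNorm N) {s : ℕ → X} {x : X} (hs : FuzzyTendsto N s x) :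
    FuzzyTendsto N (fun n => -s n) (-x) := by
  intro t ht
  refine (hs t ht).congr fun n => ?_
  rw [neg_sub_neg, h.apply_sub_comm]

lemma fuzzyTendsto_sub (h : IsFuzzyNorm N) {s u : ℕ → X} {x y : X}
    (hs : FuzzyTendsto N s x) (hu : FuzzyTendsto N u y) :
    FuzzyTendsto N (fun n => s n - u n) (x - y) := by
  simpa only [sub_eq_add_neg] using h.fuzzyTendsto_add hs (h.fuzzyTendsto_neg hu)

lemma eq_zero_of_tendsto_le (h : IsFuzzyNorm N) {x : X} {g : ℝ → ℕ → ℝ}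
    (hg : ∀ t, 0 < t → Tendsto (g t) atTop (𝓝 1)) (hle : ∀ t, 0 < t → ∀ n, g t n ≤ N x t) :
    x = 0 :=
  (h.N2 x).2 fun t ht => le_antisymm (h.le_one x t)
    (le_of_tendsto (hg t ht) (Eventually.of_forall (hle t ht)))

lemma fuzzyTendsto_unique (h : IsFuzzyNorm N) {s : ℕ → X} {x y : X}
    (hx : FuzzyTendsto N s x) (hy : FuzzyTendsto N s y) : x = y := by
  have hxy := h.fuzzyTendsto_sub hx hy
  have : -(x - y) = 0 := by
    refine h.eq_zero_of_tendsto_le (fun t ht => hxy t ht) fun t _ n => ?_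
    simp
  rwa [neg_eq_zero, sub_eq_zero] at this

lemma tendsto_apply_mul_pow (h : IsFuzzyNorm N) (x : X) {c r : ℝ} (hc : 0 < c) (hr : 1 < r) :
    Tendsto (fun n : ℕ => N x (c * r ^ n)) atTop (𝓝 1) :=
  (h.N5_lim x).comp ((tendsto_pow_atTop_atTop_of_one_lt hr).const_mul_atTop hc)

/-- A sequence whose increments are dominated geometrically has uniformly dominated differences. -/
lemma le_apply_sub_of_geometric (h : IsFuzzyNorm N) {u : ℕ → X} {δ t α : ℝ}
    (hα0 : 0 < α) (hα2 : α < 2) (ht : 0 < t) (hδ : δ ≤ 1)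
    (hu : ∀ n, δ ≤ N (u (n + 1) - u n) (t / 2 * (α / 2) ^ n)) (p n : ℕ) :
    δ ≤ N (u (n + p) - u n) (t / (2 - α) * (α / 2) ^ n) := by
  have h2 : 0 < 2 - α := sub_pos.2 hα2
  induction p generalizing n with
  | zero =>
    rw [add_zero, sub_self, h.apply_zero (by positivity)]
    exact hδ
  | succ p ih =>
    have key := (le_min (ih (n + 1)) (hu n)).trans (h.N4 _ _ _ _)
    rw [sub_add_sub_cancel, add_right_comm, add_assoc] at key
    refine key.trans_eq (congrArg _ ?_)
    rw [pow_succ]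
    field_simp
    ring

end IsFuzzyNorm

namespace IsFuzzyBanachAlgebra

variable {A : Type*} [Ring A] [Algebra ℝ A] {N : A → ℝ → ℝ}

lemma tendsto_one_of_le_mul (h : IsFuzzyBanachAlgebra N) (x : A) {s w : ℕ → A} {t : ℝ}
    (ht : 0 < t) (hs : FuzzyTendsto N s 0)
    (hw : ∀ a b n, min (N x a) (N (s n) b) ≤ N (w n) (a * b)) :
    Tendsto (fun n => N (w n) t) atTop (𝓝 1) := by
  have hF := h.toIsFuzzyNorm
  refine tendsto_order.2 ⟨fun c hc => ?_, fun c hc =>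
    Eventually.of_forall fun n => (hF.le_one _ _).trans_lt hc⟩
  obtain ⟨a, hca, ha⟩ :=
    (((hF.N5_lim x).eventually (lt_mem_nhds hc)).and (eventually_gt_atTop 0)).exists
  filter_upwards [(hs (t / a) (div_pos ht ha)).eventually (lt_mem_nhds hc)] with n hn
  have := hw a (t / a) n
  rw [mul_div_cancel₀ _ ha.ne'] at this
  rw [sub_zero] at hn
  exact (lt_min hca hn).trans_le this

lemma fuzzyTendsto_const_mul (h : IsFuzzyBanachAlgebra N) (x : A) {s : ℕ → A} {y : A}
    (hs : FuzzyTendsto N s y) : FuzzyTendsto N (fun n => x * s n) (x * y) := by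
  intro t ht
  refine h.tendsto_one_of_le_mul x ht (hs.sub_limit) fun a b n => ?_
  rw [← mul_sub]
  exact h.mul _ _ _ _

lemma fuzzyTendsto_mul_const (h : IsFuzzyBanachAlgebra N) (x : A) {s : ℕ → A} {y : A}
    (hs : FuzzyTendsto N s y) : FuzzyTendsto N (fun n => s n * x) (y * x) := by
  intro t ht
  refine h.tendsto_one_of_le_mul x ht (hs.sub_limit) fun a b n => ?_
  rw [← sub_mul, min_comm, mul_comm a b]
  exact h.mul _ _ _ _

end IsFuzzyBanachAlgebra

lemma le_control_two_pow_smul {A B : Type*} [Ring A] [Algebra ℝ A] [AddCommGroup B] [Module ℝ B]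
    {N' : B → ℝ → ℝ} (hN' : IsFuzzyNorm N') {φ : A → A → B} {α : ℝ} (hα0 : 0 < α)
    (hφ : ∀ (a b : A) (t : ℝ), 0 < t → N' (α • φ a b) t ≤ N' (φ (2 * a) (2 * b)) t)
    (a b : A) (n : ℕ) {t : ℝ} (ht : 0 < t) :
    N' (φ a b) (t / α ^ n) ≤ N' (φ ((2 ^ n : ℝ) • a) ((2 ^ n : ℝ) • b)) t := by
  induction n generalizing t with
  | zero => simp
  | succ n ih =>
    have h2 : ∀ x : A, (2 ^ (n + 1) : ℝ) • x = 2 * ((2 ^ n : ℝ) • x) := fun x => by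
      rw [two_mul, pow_succ, mul_two, add_smul]
    have h1 := hφ ((2 ^ n : ℝ) • a) ((2 ^ n : ℝ) • b) t ht
    rw [hN'.apply_smul_of_pos _ hα0] at h1
    rw [h2, h2]
    refine le_trans ?_ ((ih (div_pos ht hα0)).trans h1)
    rw [pow_succ', div_div]

lemma map_two_pow_smul_of_additive {A : Type*} [AddCommGroup A] [Module ℝ A] {d : A → A}
    (hd : ∀ a b, d (a + b) = d a + d b) (a : A) (n : ℕ) :
    d ((2 ^ n : ℝ) • a) = (2 ^ n : ℝ) • d a := by
  induction n with
  | zero => simp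
  | succ n ih => rw [pow_succ, mul_two, add_smul, hd, ih, add_smul]

/-- Theorem 3.1: fuzzy stability of ring derivations on fuzzy Banach algebras. -/
theorem stmt_14 {A : Type*} [Ring A] [Algebra ℝ A]
    {B : Type*} [AddCommGroup B] [Module ℝ B]
    (N : A → ℝ → ℝ) (N' : B → ℝ → ℝ)
    (hN : IsFuzzyBanachAlgebra N) (hN' : IsFuzzyNorm N')
    (φ : A → A → B) (α : ℝ) (hα0 : 0 < α) (hα2 : α < 2)
    (hφ : ∀ (a b : A) (t : ℝ), 0 < t → N' (α • φ a b) t ≤ N' (φ (2 * a) (2 * b)) t)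
    (f : A → A)
    (hadd : ∀ (a b : A) (t : ℝ), 0 < t → N' (φ a b) t ≤ N (f (a + b) - f a - f b) t)
    (hder : ∀ (a b : A) (s : ℝ), 0 < s → N' (φ a b) s ≤ N (f (a * b) - a * f b - f a * b) s) :
    ∃! d : A → A,
      ((∀ a b : A, d (a + b) = d a + d b) ∧ (∀ a b : A, d (a * b) = a * d b + d a * b)) ∧
      ∀ (a : A) (t : ℝ), 0 < t → N' ((2 / (2 - α)) • φ a a) t ≤ N (f a - d a) t := by
  have hF := hN.toIsFuzzyNorm
  have h2α : 0 < 2 - α := sub_pos.2 hα2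
  have hr : 1 < 2 / α := (one_lt_div hα0).2 hα2
  have hpow := fun (a b : A) (n : ℕ) {t : ℝ} (ht : 0 < t) =>
    le_control_two_pow_smul hN' hα0 hφ a b n ht
  let u : A → ℕ → A := fun a n => ((2 ^ n : ℝ)⁻¹) • f ((2 ^ n : ℝ) • a)
  have hstep : ∀ (a : A) (t : ℝ), 0 < t → ∀ n,
      N' (φ a a) t ≤ N (u a (n + 1) - u a n) (t / 2 * (α / 2) ^ n) := by
    intro a t ht n
    have h1 := (hpow a a n (t := t * α ^ n) (by positivity)).trans
      (hadd ((2 ^ n : ℝ) • a) ((2 ^ n : ℝ) • a) (t * α ^ n) (by positivity))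
    rw [mul_div_cancel_right₀ _ (by positivity)] at h1
    have h2 : u a (n + 1) - u a n = ((2 ^ (n + 1) : ℝ)⁻¹) •
        (f ((2 ^ n : ℝ) • a + (2 ^ n : ℝ) • a) - f ((2 ^ n : ℝ) • a) - f ((2 ^ n : ℝ) • a)) := by
      simp only [u]
      rw [← add_smul, ← mul_two, ← pow_succ]
      have : ((2 ^ n : ℝ)⁻¹) = (2 ^ (n + 1) : ℝ)⁻¹ * 2 := by
        rw [pow_succ]; field_simp
      rw [this, mul_smul, two_smul, sub_sub, smul_sub, smul_add]
    rw [h2, hF.apply_smul_of_pos _ (by positivity)]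
    refine h1.trans_eq (congrArg _ ?_)
    rw [div_pow, pow_succ]
    field_simp
  have hdiff : ∀ (a : A) (t : ℝ), 0 < t → ∀ p n,
      N' (φ a a) t ≤ N (u a (n + p) - u a n) (t / (2 - α) * (α / 2) ^ n) := fun a t ht =>
    hF.le_apply_sub_of_geometric hα0 hα2 ht (hN'.le_one _ _) (hstep a t ht)
  have hcauchy : ∀ a, FuzzyCauchy N (u a) := by
    intro a ε hε b hb
    obtain ⟨t, hεt, ht⟩ := (((hN'.N5_lim (φ a a)).eventually
      (lt_mem_nhds (sub_lt_self 1 hε))).and (eventually_gt_atTop 0)).exists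
    have hlim : Tendsto (fun n : ℕ => t / (2 - α) * (α / 2) ^ n) atTop (𝓝 0) := by
      simpa using (tendsto_pow_atTop_nhds_zero_of_lt_one (by positivity)
        ((div_lt_one two_pos).2 hα2)).const_mul (t / (2 - α))
    obtain ⟨n₀, hn₀⟩ := eventually_atTop.1 (hlim.eventually (gt_mem_nhds hb))
    exact ⟨n₀, fun n hn p _ =>
      hεt.trans_le ((hdiff a t ht p n).trans (hF.N5_mono _ (hn₀ n hn).le))⟩
  choose d hd using fun a => hN.complete (u a) (hcauchy a)
  refine ⟨d, ⟨⟨fun a b => ?_, fun a b => ?_⟩, fun a t ht => ?_⟩, ?_⟩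
  · have hlim := hF.fuzzyTendsto_sub (hF.fuzzyTendsto_sub (hd (a + b)) (hd a)) (hd b)
    have hzero : FuzzyTendsto N (fun n => u (a + b) n - u a n - u b n) 0 := by
      intro t ht
      refine hF.tendsto_one_of_le (hN'.tendsto_apply_mul_pow (φ a b) ht hr) fun n => ?_
      have h1 := (hpow a b n (t := t * 2 ^ n) (by positivity)).trans
        (hadd ((2 ^ n : ℝ) • a) ((2 ^ n : ℝ) • b) (t * 2 ^ n) (by positivity))
      simp only [u]
      rw [sub_zero, ← smul_sub, ← smul_sub, hF.apply_smul_of_pos _ (by positivity), smul_add,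
        div_inv_eq_mul, div_pow, ← mul_div_assoc]
      exact h1
    have := hF.fuzzyTendsto_unique hlim hzero
    rwa [sub_sub, sub_eq_zero] at this
  · have hsub : FuzzyTendsto N (fun n => u (a * b) (n + n)) (d (a * b)) := fun t ht =>
      (hd (a * b) t ht).comp (tendsto_atTop_mono (fun n => Nat.le_add_right n n) tendsto_id)
    have hlim := hF.fuzzyTendsto_sub
      (hF.fuzzyTendsto_sub hsub (hN.fuzzyTendsto_const_mul a (hd b)))
      (hN.fuzzyTendsto_mul_const b (hd a))
    have hzero : FuzzyTendsto N (fun n => u (a * b) (n + n) - a * u b n - u a n * b) 0 := by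
      intro t ht
      refine hF.tendsto_one_of_le (hN'.tendsto_apply_mul_pow (φ a b) ht hr) fun n => ?_
      have h1 := (hpow a b n (t := t * 2 ^ (n + n)) (by positivity)).trans
        (hder ((2 ^ n : ℝ) • a) ((2 ^ n : ℝ) • b) (t * 2 ^ (n + n)) (by positivity))
      have h2 : u (a * b) (n + n) - a * u b n - u a n * b = ((2 ^ (n + n) : ℝ)⁻¹) •
          (f ((2 ^ n : ℝ) • a * (2 ^ n : ℝ) • b) - (2 ^ n : ℝ) • a * f ((2 ^ n : ℝ) • b)
            - f ((2 ^ n : ℝ) • a) * (2 ^ n : ℝ) • b) := by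
        have h3 : (2 ^ (n + n) : ℝ)⁻¹ * 2 ^ n = (2 ^ n)⁻¹ := by
          rw [pow_add]; field_simp
        simp only [u]
        rw [smul_mul_smul_comm, ← pow_add, smul_sub, smul_sub, smul_mul_assoc, mul_smul_comm,
          mul_smul_comm, smul_mul_assoc, smul_smul, smul_smul, h3]
      beta_reduce
      rw [sub_zero, h2, hF.apply_smul_of_pos _ (by positivity), div_inv_eq_mul]
      refine le_trans (hN'.N5_mono _ ?_) h1
      rw [div_pow, ← mul_div_assoc]
      gcongr
      · norm_num
      · exact Nat.le_add_right n n
    have := hF.fuzzyTendsto_unique hlim hzero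
    rwa [sub_sub, sub_eq_zero] at this
  · have hT : 0 < (2 - α) / 2 * t := by positivity
    have hbound : ∀ n, min (N' (φ a a) ((2 - α) / 2 * t)) (N (u a n - d a) (t / 2))
        ≤ N (f a - d a) t := by
      intro n
      have h1 := hdiff a _ hT n 0
      have h2 : (2 - α) / 2 * t / (2 - α) * (α / 2) ^ 0 = t / 2 := by
        field_simp
      rw [h2, zero_add, hF.apply_sub_comm] at h1
      have h3 := (min_le_min_right _ h1).trans (hF.N4 _ (u a n - d a) _ (t / 2))
      rw [sub_add_sub_cancel, add_halves] at h3
      simpa [u] using h3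
    have h4 := le_of_tendsto (tendsto_const_nhds.min (hd a (t / 2) (half_pos ht)))
      (Eventually.of_forall hbound)
    rw [min_eq_left (hN'.le_one _ _)] at h4
    rw [hN'.apply_smul_of_pos _ (by positivity)]
    refine (congrArg _ ?_).trans_le h4
    field_simp
  · rintro e ⟨⟨he, -⟩, hbe⟩
    funext a
    refine hF.fuzzyTendsto_unique (fun t ht => ?_) (hd a)
    have hC : 0 < t / (2 / (2 - α)) := by positivity
    refine hF.tendsto_one_of_le (hN'.tendsto_apply_mul_pow (φ a a) hC hr) fun n => ?_
    have h1 := hbe ((2 ^ n : ℝ) • a) (t * 2 ^ n) (by positivity)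
    rw [hN'.apply_smul_of_pos _ (by positivity)] at h1
    have h2 := (hpow a a n (t := t * 2 ^ n / (2 / (2 - α))) (by positivity)).trans h1
    have h3 : u a n - e a = ((2 ^ n : ℝ)⁻¹) • (f ((2 ^ n : ℝ) • a) - e ((2 ^ n : ℝ) • a)) := by
      rw [map_two_pow_smul_of_additive he, smul_sub, inv_smul_smul₀ (by positivity)]
    rw [h3, hF.apply_smul_of_pos _ (by positivity), div_inv_eq_mul]
    refine (congrArg _ ?_).trans_le h2
    rw [div_pow]
    field_simp
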